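/- arXiv:2503.08821 — 5 statements merged into one kernel-verified Lean document; each statement's English description precedes it below -/
import Mathlib

section
/- For every family of coefficients (c_{j,k}) as in the context (uniformly bounded, supported in k ∈ {0,…,2^j−1}, with all 1-leaders strictly positive), the two leader scaling functions coincide: for every q ∈ ℝ, ζ₁(q) = ζ₃(q). -/
/-- The dyadic interval `λ_{j,k} = [k·2^{-j}, (k+1)·2^{-j})` of generation `j`. -/
noncomputable def dyadic (j : ℕ) (k : ℤ) : Set ℝ :=
  Set.Ico ((k : ℝ) / 2 ^ j) (((k : ℝ) + 1) / 2 ^ j)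

/-- The interval `3λ_{j,k}` with the same center and three times the width. -/
noncomputable def dyadic3 (j : ℕ) (k : ℤ) : Set ℝ :=
  dyadic j (k - 1) ∪ dyadic j k ∪ dyadic j (k + 1)

/-- The 1-leader `ℓ¹_{j,k} = sup { |c_{j',k'}| : λ_{j',k'} ⊆ λ_{j,k} }`. -/
noncomputable def leader1 (c : ℕ → ℤ → ℝ) (j : ℕ) (k : ℤ) : ℝ :=
  sSup { y : ℝ | ∃ j' : ℕ, ∃ k' : ℤ, dyadic j' k' ⊆ dyadic j k ∧ y = |c j' k'| }

/-- The 3-leader `ℓ³_{j,k} = sup { |c_{j',k'}| : λ_{j',k'} ⊆ 3λ_{j,k} }`. -/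
noncomputable def leader3 (c : ℕ → ℤ → ℝ) (j : ℕ) (k : ℤ) : ℝ :=
  sSup { y : ℝ | ∃ j' : ℕ, ∃ k' : ℤ, dyadic j' k' ⊆ dyadic3 j k ∧ y = |c j' k'| }

/-- The structure function `S(j,q) = 2^{-j} ∑_{k=0}^{2^j−1} L(j,k)^q`
built from a multiresolution quantity `L`. -/
noncomputable def structureFn (L : ℕ → ℤ → ℝ) (j : ℕ) (q : ℝ) : ℝ :=
  (2 : ℝ) ^ (-(j : ℝ)) * ∑ k ∈ Finset.range (2 ^ j), (L j (k : ℤ)) ^ q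

/-- The scaling function `ζ(q) = liminf_{j→∞} log S(j,q) / log 2^{-j}`. -/
noncomputable def scalingFn (L : ℕ → ℤ → ℝ) (q : ℝ) : ℝ :=
  Filter.liminf
    (fun j : ℕ => Real.log (structureFn L j q) / Real.log ((2 : ℝ) ^ (-(j : ℝ))))
    Filter.atTop

lemma sSup_le_sSup_of_forall_sub_mem {A B : Set ℝ} (hAB : ∀ a ∈ A, ∀ ε > 0, a - ε ∈ B)
    (hB : BddAbove B) (hA : A.Nonempty) : sSup A ≤ sSup B :=
  csSup_le hA fun a ha => le_of_forall_pos_le_add fun ε hε => by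
    linarith [le_csSup hB (hAB a ha ε hε)]

lemma sSup_eq_sSup_of_forall_sub_mem {A B : Set ℝ} (hAB : ∀ a ∈ A, ∀ ε > 0, a - ε ∈ B)
    (hBA : ∀ b ∈ B, ∀ ε > 0, b - ε ∈ A) : sSup A = sSup B := by
  have bdd : ∀ {X Y : Set ℝ}, (∀ a ∈ X, ∀ ε > 0, a - ε ∈ Y) → BddAbove Y → BddAbove X := by
    rintro X Y h ⟨M, hM⟩
    exact ⟨M + 1, fun a ha => by linarith [hM (h a ha 1 one_pos)]⟩
  rcases A.eq_empty_or_nonempty with rfl | ⟨a, ha⟩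
  · rcases B.eq_empty_or_nonempty with rfl | ⟨b, hb⟩
    · rfl
    · exact absurd (hBA b hb 1 one_pos) (Set.notMem_empty _)
  by_cases hA : BddAbove A
  · exact le_antisymm (sSup_le_sSup_of_forall_sub_mem hAB (bdd hBA hA) ⟨a, ha⟩)
      (sSup_le_sSup_of_forall_sub_mem hBA hA ⟨_, hAB a ha 1 one_pos⟩)
  · rw [Real.sSup_of_not_bddAbove hA, Real.sSup_of_not_bddAbove fun hB => hA (bdd hAB hB)]

lemma le_log_div_log_two_rpow_neg_iff {s a : ℝ} {j : ℕ} (hj : 0 < j) :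
    a ≤ Real.log s / Real.log ((2 : ℝ) ^ (-(j : ℝ))) ↔
      Real.log s ≤ -(a * (j * Real.log 2)) := by
  have h2 : 0 < (j : ℝ) * Real.log 2 :=
    mul_pos (by exact_mod_cast hj) (Real.log_pos one_lt_two)
  rw [Real.log_rpow two_pos, neg_mul, div_neg, le_neg, div_le_iff₀ h2, neg_mul]

/-- Up to an arbitrarily small loss, eventual lower bounds on the scaling exponents pass from `S`
to `T` when `T` is controlled by `S` up to a constant and a shift of the scales. -/
lemma eventually_sub_le_log_div_log {S T : ℕ → ℝ} (hS : ∀ j, 0 < S j) (hT : ∀ j, 0 < T j)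
    {K : ℝ} (hK : 0 < K) {d e : ℕ} (h : ∀ j, T (j + d) ≤ K * S (j + e)) {a ε : ℝ} (hε : 0 < ε)
    (ha : ∀ᶠ j : ℕ in Filter.atTop, a ≤ Real.log (S j) / Real.log ((2 : ℝ) ^ (-(j : ℝ)))) :
    ∀ᶠ j : ℕ in Filter.atTop, a - ε ≤ Real.log (T j) / Real.log ((2 : ℝ) ^ (-(j : ℝ))) := by
  have hlim : Filter.Tendsto (fun j : ℕ => (j : ℝ) * (ε * Real.log 2)) Filter.atTop
      Filter.atTop :=
    tendsto_natCast_atTop_atTop.atTop_mul_const (mul_pos hε (Real.log_pos one_lt_two))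
  rw [← Filter.map_add_atTop_eq_nat d, Filter.eventually_map]
  filter_upwards [(Filter.tendsto_add_atTop_nat e).eventually ha,
    Filter.eventually_gt_atTop 0,
    hlim.eventually_ge_atTop (Real.log K - a * e * Real.log 2 + (a - ε) * d * Real.log 2)]
    with j hj hj0 hlarge
  rw [le_log_div_log_two_rpow_neg_iff (by omega)] at hj ⊢
  have hlog := Real.log_le_log (hT _) (h j)
  rw [Real.log_mul hK.ne' (hS _).ne'] at hlog
  push_cast at hj ⊢
  linarith

lemma dyadic_subset_Ico_iff {j' j : ℕ} {k' a b : ℤ} :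
    dyadic j' k' ⊆ Set.Ico ((a : ℝ) / 2 ^ j) ((b : ℝ) / 2 ^ j) ↔
      a * 2 ^ j' ≤ k' * 2 ^ j ∧ (k' + 1) * 2 ^ j ≤ b * 2 ^ j' := by
  have hlt : (k' : ℝ) / 2 ^ j' < ((k' : ℝ) + 1) / 2 ^ j' := by gcongr; linarith
  rw [dyadic, Set.Ico_subset_Ico_iff hlt, div_le_div_iff₀ (by positivity) (by positivity),
    div_le_div_iff₀ (by positivity) (by positivity)]
  norm_cast

lemma dyadic_subset_dyadic_iff {j' j : ℕ} {k' k : ℤ} :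
    dyadic j' k' ⊆ dyadic j k ↔
      k * 2 ^ j' ≤ k' * 2 ^ j ∧ (k' + 1) * 2 ^ j ≤ (k + 1) * 2 ^ j' := by
  rw [← dyadic_subset_Ico_iff]
  push_cast
  rfl

lemma dyadic3_eq_Ico (j : ℕ) (k : ℤ) :
    dyadic3 j k = Set.Ico (((k - 1 : ℤ) : ℝ) / 2 ^ j) (((k + 2 : ℤ) : ℝ) / 2 ^ j) := by
  simp only [dyadic3, dyadic]
  push_cast
  rw [sub_add_cancel, Set.Ico_union_Ico_eq_Ico (by gcongr; linarith) (by gcongr; linarith),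
    Set.Ico_union_Ico_eq_Ico (by gcongr; linarith) (by gcongr; linarith)]
  congr 2
  ring

lemma dyadic_subset_dyadic3_iff {j' j : ℕ} {k' k : ℤ} :
    dyadic j' k' ⊆ dyadic3 j k ↔
      (k - 1) * 2 ^ j' ≤ k' * 2 ^ j ∧ (k' + 1) * 2 ^ j ≤ (k + 2) * 2 ^ j' := by
  rw [dyadic3_eq_Ico, dyadic_subset_Ico_iff]

lemma dyadic_subset_dyadic3 (j : ℕ) (k : ℤ) : dyadic j k ⊆ dyadic3 j k :=
  fun _ hx => Or.inl (Or.inr hx)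

lemma dyadic3_subset_dyadic (j : ℕ) (k : ℤ) : dyadic3 (j + 2) (4 * k + 1) ⊆ dyadic j k := by
  rw [dyadic3_eq_Ico, dyadic]
  refine Set.Ico_subset_Ico (le_of_eq ?_) ?_
  · push_cast
    field_simp
    ring
  · rw [div_le_div_iff₀ (by positivity) (by positivity)]
    push_cast
    have : (0 : ℝ) < 2 ^ j := by positivity
    rw [pow_add]
    nlinarith

/-- A dyadic interval contained in `3λ_{j+1,k}` lies in the parent of `λ_{j+1,k}` or in one of the
two neighbours of that parent. -/
lemma exists_dyadic_superset_of_subset_dyadic3 {j' j : ℕ} {k' k : ℤ}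
    (h : dyadic j' k' ⊆ dyadic3 (j + 1) k) :
    ∃ m : ℤ, (m = k / 2 - 1 ∨ m = k / 2 ∨ m = k / 2 + 1) ∧ dyadic j' k' ⊆ dyadic j m := by
  obtain ⟨h1, h2⟩ := dyadic_subset_dyadic3_iff.1 h
  have hj : j ≤ j' := by
    by_contra! hlt
    obtain ⟨d, rfl⟩ := Nat.exists_eq_add_of_lt hlt
    have hp : (0 : ℤ) < 2 ^ j' := by positivity
    have hd : (1 : ℤ) ≤ 2 ^ d := one_le_pow₀ (by norm_num)
    have e : (2 : ℤ) ^ (j' + d + 1 + 1) = 4 * 2 ^ d * 2 ^ j' := by ring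
    rw [e] at h1 h2
    have : (4 * 2 ^ d) * (2 : ℤ) ^ j' ≤ 3 * 2 ^ j' := by linarith
    nlinarith
  obtain ⟨d, rfl⟩ := Nat.exists_eq_add_of_le hj
  have hJ : (0 : ℤ) < 2 ^ j := by positivity
  have hD : (0 : ℤ) < 2 ^ d := by positivity
  have h1' : (k - 1) * 2 ^ d ≤ 2 * k' := by
    refine le_of_mul_le_mul_right ?_ hJ
    calc _ = (k - 1) * 2 ^ (j + d) := by ring
      _ ≤ _ := h1
      _ = _ := by ring
  have h2' : 2 * (k' + 1) ≤ (k + 2) * 2 ^ d := by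
    refine le_of_mul_le_mul_right ?_ hJ
    calc _ = (k' + 1) * 2 ^ (j + 1) := by ring
      _ ≤ _ := h2
      _ = _ := by ring
  have hm1 : k' / 2 ^ d * 2 ^ d ≤ k' := Int.ediv_mul_le _ hD.ne'
  have hm2 : k' + 1 ≤ (k' / 2 ^ d + 1) * 2 ^ d := Int.lt_ediv_add_one_mul_self _ hD
  refine ⟨k' / 2 ^ d, ?_, dyadic_subset_dyadic_iff.2 ⟨?_, ?_⟩⟩
  · generalize k' / 2 ^ d = m at hm1 hm2
    have hlo : k - 1 < 2 * (m + 1) := lt_of_mul_lt_mul_right (by linarith) hD.le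
    have hhi : 2 * m < k + 2 := lt_of_mul_lt_mul_right (by linarith) hD.le
    omega
  · calc _ = (k' / 2 ^ d * 2 ^ d) * 2 ^ j := by ring
      _ ≤ _ := by gcongr
  · calc _ ≤ ((k' / 2 ^ d + 1) * 2 ^ d) * 2 ^ j := by gcongr
      _ = _ := by ring

section Leaders

variable {c : ℕ → ℤ → ℝ}

lemma leader1_nonneg (c : ℕ → ℤ → ℝ) (j : ℕ) (k : ℤ) : 0 ≤ leader1 c j k :=
  Real.sSup_nonneg (by rintro _ ⟨_, _, _, rfl⟩; exact abs_nonneg _)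

lemma leader3_nonneg (c : ℕ → ℤ → ℝ) (j : ℕ) (k : ℤ) : 0 ≤ leader3 c j k :=
  Real.sSup_nonneg (by rintro _ ⟨_, _, _, rfl⟩; exact abs_nonneg _)

lemma abs_le_leader1 (hbd : ∃ C : ℝ, ∀ (j : ℕ) (k : ℤ), |c j k| ≤ C) {j' j : ℕ} {k' k : ℤ}
    (h : dyadic j' k' ⊆ dyadic j k) : |c j' k'| ≤ leader1 c j k := by
  obtain ⟨C, hC⟩ := hbd
  exact le_csSup ⟨C, by rintro _ ⟨_, _, _, rfl⟩; exact hC _ _⟩ ⟨j', k', h, rfl⟩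

lemma abs_le_leader3 (hbd : ∃ C : ℝ, ∀ (j : ℕ) (k : ℤ), |c j k| ≤ C) {j' j : ℕ} {k' k : ℤ}
    (h : dyadic j' k' ⊆ dyadic3 j k) : |c j' k'| ≤ leader3 c j k := by
  obtain ⟨C, hC⟩ := hbd
  exact le_csSup ⟨C, by rintro _ ⟨_, _, _, rfl⟩; exact hC _ _⟩ ⟨j', k', h, rfl⟩

lemma leader1_le_leader3 (hbd : ∃ C : ℝ, ∀ (j : ℕ) (k : ℤ), |c j k| ≤ C) (j : ℕ) (k : ℤ) :
    leader1 c j k ≤ leader3 c j k := by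
  refine Real.sSup_le ?_ (leader3_nonneg c j k)
  rintro _ ⟨_, _, h, rfl⟩
  exact abs_le_leader3 hbd (h.trans (dyadic_subset_dyadic3 j k))

lemma leader3_le_leader1 (hbd : ∃ C : ℝ, ∀ (j : ℕ) (k : ℤ), |c j k| ≤ C) (j : ℕ) (k : ℤ) :
    leader3 c (j + 2) (4 * k + 1) ≤ leader1 c j k := by
  refine Real.sSup_le ?_ (leader1_nonneg c j k)
  rintro _ ⟨_, _, h, rfl⟩
  exact abs_le_leader1 hbd (h.trans (dyadic3_subset_dyadic j k))

lemma leader3_le_max_leader1 (hbd : ∃ C : ℝ, ∀ (j : ℕ) (k : ℤ), |c j k| ≤ C) (j : ℕ) (k : ℤ) :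
    leader3 c (j + 1) k ≤
      max (leader1 c j (k / 2 - 1)) (max (leader1 c j (k / 2)) (leader1 c j (k / 2 + 1))) := by
  refine Real.sSup_le ?_ (le_max_of_le_left (leader1_nonneg c j _))
  rintro _ ⟨_, _, h, rfl⟩
  obtain ⟨m, rfl | rfl | rfl, hm⟩ := exists_dyadic_superset_of_subset_dyadic3 h
  · exact le_max_of_le_left (abs_le_leader1 hbd hm)
  · exact le_max_of_le_right (le_max_of_le_left (abs_le_leader1 hbd hm))
  · exact le_max_of_le_right (le_max_of_le_right (abs_le_leader1 hbd hm))

lemma leader1_eq_zero (hsupp : ∀ (j : ℕ) (k : ℤ), (k < 0 ∨ (2 : ℤ) ^ j ≤ k) → c j k = 0)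
    {j : ℕ} {k : ℤ} (hk : k < 0 ∨ (2 : ℤ) ^ j ≤ k) : leader1 c j k = 0 := by
  refine le_antisymm (Real.sSup_le ?_ le_rfl) (leader1_nonneg c j k)
  rintro _ ⟨j', k', h, rfl⟩
  obtain ⟨h1, h2⟩ := dyadic_subset_dyadic_iff.1 h
  have hj : (0 : ℤ) < 2 ^ j := by positivity
  have hj' : (0 : ℤ) < 2 ^ j' := by positivity
  rw [hsupp j' k', abs_zero]
  rcases hk with hk | hk
  · left
    by_contra! hk'
    nlinarith [mul_nonneg (by omega : (0 : ℤ) ≤ -(k + 1)) hj'.le, mul_nonneg hk' hj.le]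
  · right
    refine le_of_mul_le_mul_right (le_trans ?_ h1) hj
    rw [mul_comm]
    gcongr

end Leaders

lemma structureFn_pos {L : ℕ → ℤ → ℝ} {j : ℕ}
    (hL : ∀ k : ℤ, 0 ≤ k → k < (2 : ℤ) ^ j → 0 < L j k) (q : ℝ) : 0 < structureFn L j q := by
  refine mul_pos (by positivity) (Finset.sum_pos (fun k hk => ?_) ⟨0, by simp⟩)
  exact Real.rpow_pos_of_pos
    (hL k (by positivity) (by exact_mod_cast Finset.mem_range.1 hk)) q

lemma sum_range_two_mul_div_two (g : ℕ → ℝ) (n : ℕ) :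
    ∑ k ∈ Finset.range (2 * n), g (k / 2) = 2 * ∑ k ∈ Finset.range n, g k := by
  induction n with
  | zero => simp
  | succ n ih =>
    rw [show 2 * (n + 1) = 2 * n + 1 + 1 by ring, Finset.sum_range_succ, Finset.sum_range_succ,
      Finset.sum_range_succ, ih, show (2 * n + 1) / 2 = n by omega, show 2 * n / 2 = n by omega]
    ring

lemma sum_range_sub_one_le {f : ℤ → ℝ} (hf : ∀ k, 0 ≤ f k) (h0 : f (-1) = 0) (n : ℕ) :
    ∑ k ∈ Finset.range n, f (k - 1) ≤ ∑ k ∈ Finset.range n, f k := by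
  cases n with
  | zero => simp
  | succ n =>
    rw [Finset.sum_range_succ', Finset.sum_range_succ]
    simp [h0, hf]

lemma sum_range_add_one_le {f : ℤ → ℝ} (hf : ∀ k, 0 ≤ f k) {n : ℕ} (hn : f n = 0) :
    ∑ k ∈ Finset.range n, f (k + 1) ≤ ∑ k ∈ Finset.range n, f k := by
  have h := Finset.sum_range_succ' (fun k : ℕ => f k) n
  rw [Finset.sum_range_succ, hn] at h
  push_cast at h
  linarith [hf 0]

lemma structureFn_leader3_succ_le {c : ℕ → ℤ → ℝ}
    (hbd : ∃ C : ℝ, ∀ (j : ℕ) (k : ℤ), |c j k| ≤ C)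
    (hsupp : ∀ (j : ℕ) (k : ℤ), (k < 0 ∨ (2 : ℤ) ^ j ≤ k) → c j k = 0)
    {q : ℝ} (hq : 0 < q) (j : ℕ) :
    structureFn (leader3 c) (j + 1) q ≤ 3 * structureFn (leader1 c) j q := by
  set f : ℤ → ℝ := fun k => leader1 c j k ^ q with hf
  have hf0 : ∀ k, 0 ≤ f k := fun k => Real.rpow_nonneg (leader1_nonneg c j k) q
  have hout : ∀ k : ℤ, (k < 0 ∨ (2 : ℤ) ^ j ≤ k) → f k = 0 := fun k hk => by
    simp only [hf, leader1_eq_zero hsupp hk, Real.zero_rpow hq.ne']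
  have hterm : ∀ k : ℤ,
      leader3 c (j + 1) k ^ q ≤ f (k / 2 - 1) + f (k / 2) + f (k / 2 + 1) := fun k => by
    have h := Real.rpow_le_rpow (leader3_nonneg c _ _) (leader3_le_max_leader1 hbd j k) hq.le
    have h1 := hf0 (k / 2 - 1)
    have h2 := hf0 (k / 2)
    have h3 := hf0 (k / 2 + 1)
    simp only [hf] at h1 h2 h3 ⊢
    rcases max_choice (leader1 c j (k / 2 - 1))
      (max (leader1 c j (k / 2)) (leader1 c j (k / 2 + 1))) with e | e <;> rw [e] at h
    · linarith
    · rcases max_choice (leader1 c j (k / 2)) (leader1 c j (k / 2 + 1)) with e' | e' <;>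
        rw [e'] at h <;> linarith
  have hsum : ∑ k ∈ Finset.range (2 ^ (j + 1)), leader3 c (j + 1) k ^ q ≤
      6 * ∑ k ∈ Finset.range (2 ^ j), f k := by
    calc ∑ k ∈ Finset.range (2 ^ (j + 1)), leader3 c (j + 1) k ^ q
        ≤ ∑ k ∈ Finset.range (2 * 2 ^ j), (f ((k / 2 : ℕ) - 1) + f ((k / 2 : ℕ)) +
            f ((k / 2 : ℕ) + 1)) := by
          rw [pow_succ']
          exact Finset.sum_le_sum fun k _ => by exact_mod_cast hterm k
      _ = 2 * ∑ k ∈ Finset.range (2 ^ j), (f (k - 1) + f k + f (k + 1)) :=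
          sum_range_two_mul_div_two (fun k : ℕ => f (k - 1) + f k + f (k + 1)) _
      _ ≤ _ := by
          rw [Finset.sum_add_distrib, Finset.sum_add_distrib]
          linarith [sum_range_sub_one_le hf0 (hout (-1) (by simp)) (2 ^ j),
            sum_range_add_one_le hf0 (n := 2 ^ j) (hout _ (by simp))]
  have hpow : (2 : ℝ) ^ (-((j + 1 : ℕ) : ℝ)) = 2 ^ (-(j : ℝ)) / 2 := by
    push_cast
    rw [neg_add, ← sub_eq_add_neg, Real.rpow_sub_one two_ne_zero]
  have hpos : (0 : ℝ) < 2 ^ (-(j : ℝ)) := by positivity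
  rw [structureFn, structureFn, hpow]
  calc _ ≤ (2 : ℝ) ^ (-(j : ℝ)) / 2 * (6 * ∑ k ∈ Finset.range (2 ^ j), f k) := by gcongr
    _ = _ := by ring

lemma structureFn_leader1_le {c : ℕ → ℤ → ℝ}
    (hbd : ∃ C : ℝ, ∀ (j : ℕ) (k : ℤ), |c j k| ≤ C)
    (hpos : ∀ (j : ℕ) (k : ℤ), 0 ≤ k → k < (2 : ℤ) ^ j → 0 < leader1 c j k)
    {q : ℝ} (hq : q ≤ 0) (j : ℕ) :
    structureFn (leader1 c) j q ≤ 4 * structureFn (leader3 c) (j + 2) q := by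
  have hsum : ∑ k ∈ Finset.range (2 ^ j), leader1 c j k ^ q ≤
      ∑ k ∈ Finset.range (2 ^ (j + 2)), leader3 c (j + 2) k ^ q := by
    calc ∑ k ∈ Finset.range (2 ^ j), leader1 c j k ^ q
        ≤ ∑ k ∈ Finset.range (2 ^ j), leader3 c (j + 2) ((4 * k + 1 : ℕ) : ℤ) ^ q := by
          refine Finset.sum_le_sum fun k hk => ?_
          have hk : (k : ℤ) < 2 ^ j := by exact_mod_cast Finset.mem_range.1 hk
          push_cast
          refine Real.rpow_le_rpow_of_nonpos ?_ (leader3_le_leader1 hbd j k) hq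
          refine (hpos (j + 2) _ (by positivity) ?_).trans_le (leader1_le_leader3 hbd _ _)
          rw [pow_add]
          omega
      _ = ∑ k ∈ (Finset.range (2 ^ j)).image (fun k : ℕ => 4 * k + 1),
            leader3 c (j + 2) (k : ℤ) ^ q :=
          (Finset.sum_image (f := fun k : ℕ => leader3 c (j + 2) k ^ q)
            fun a _ b _ (h : 4 * a + 1 = 4 * b + 1) => by omega).symm
      _ ≤ _ := by
          refine Finset.sum_le_sum_of_subset_of_nonneg ?_
            fun k _ _ => Real.rpow_nonneg (leader3_nonneg c _ _) q
          intro k hk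
          obtain ⟨m, hm, rfl⟩ := Finset.mem_image.1 hk
          rw [Finset.mem_range] at hm ⊢
          rw [pow_add]
          omega
  have hpow : (2 : ℝ) ^ (-((j + 2 : ℕ) : ℝ)) = 2 ^ (-(j : ℝ)) / 4 := by
    push_cast
    rw [neg_add, ← sub_eq_add_neg, Real.rpow_sub two_pos]
    norm_num
  rw [structureFn, structureFn, hpow]
  calc _ ≤ (2 : ℝ) ^ (-(j : ℝ)) * ∑ k ∈ Finset.range (2 ^ (j + 2)), leader3 c (j + 2) k ^ q := by
        gcongr
    _ = _ := by ring

/-- For uniformly bounded coefficients supported in `k ∈ {0,…,2^j−1}` with all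
1-leaders strictly positive, the 1-leader and the 3-leader scaling functions coincide:
`ζ₁(q) = ζ₃(q)` for every `q ∈ ℝ`. -/
theorem leader_scaling_functions_coincide (c : ℕ → ℤ → ℝ)
    (hbd : ∃ C : ℝ, ∀ (j : ℕ) (k : ℤ), |c j k| ≤ C)
    (hsupp : ∀ (j : ℕ) (k : ℤ), (k < 0 ∨ (2 : ℤ) ^ j ≤ k) → c j k = 0)
    (hpos : ∀ (j : ℕ) (k : ℤ), 0 ≤ k → k < (2 : ℤ) ^ j → 0 < leader1 c j k) :
    ∀ q : ℝ, scalingFn (leader1 c) q = scalingFn (leader3 c) q := by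
  intro q
  have hS1 : ∀ j, 0 < structureFn (leader1 c) j q := fun j => structureFn_pos (hpos j) q
  have hS3 : ∀ j, 0 < structureFn (leader3 c) j q := fun j =>
    structureFn_pos (fun k h0 h1 => (hpos j k h0 h1).trans_le (leader1_le_leader3 hbd j k)) q
  simp only [scalingFn, Filter.liminf_eq]
  rcases lt_or_ge 0 q with hq | hq
  · have h13 : ∀ j, structureFn (leader1 c) j q ≤ 1 * structureFn (leader3 c) j q := fun j => by
      rw [one_mul]
      refine mul_le_mul_of_nonneg_left (Finset.sum_le_sum fun k _ => ?_) (by positivity)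
      exact Real.rpow_le_rpow (leader1_nonneg c j k) (leader1_le_leader3 hbd j k) hq.le
    exact sSup_eq_sSup_of_forall_sub_mem
      (fun a ha ε hε => eventually_sub_le_log_div_log hS1 hS3 three_pos (d := 1) (e := 0)
        (structureFn_leader3_succ_le hbd hsupp hq) hε ha)
      (fun a ha ε hε => eventually_sub_le_log_div_log hS3 hS1 one_pos (d := 0) (e := 0)
        h13 hε ha)
  · have h31 : ∀ j, structureFn (leader3 c) j q ≤ 1 * structureFn (leader1 c) j q := fun j => by
      rw [one_mul]
      refine mul_le_mul_of_nonneg_left (Finset.sum_le_sum fun k hk => ?_) (by positivity)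
      exact Real.rpow_le_rpow_of_nonpos
        (hpos j k (by positivity) (by exact_mod_cast Finset.mem_range.1 hk))
        (leader1_le_leader3 hbd j k) hq
    exact sSup_eq_sSup_of_forall_sub_mem
      (fun a ha ε hε => eventually_sub_le_log_div_log hS1 hS3 one_pos (d := 0) (e := 0)
        h31 hε ha)
      (fun a ha ε hε => eventually_sub_le_log_div_log hS3 hS1 four_pos (d := 0) (e := 2)
        (structureFn_leader1_le hbd hpos hq) hε ha)
end

section
/- (General bounds for the Mills ratio, convex case.) Assume in addition that g''(t) ≥ 0 for all t ≥ 0. Then for every x > 0: f(x)/(g'(x)·(1 + M(x))) ≤ I(x) ≤ f(x)/g'(x). -/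
open MeasureTheory

/-- A function whose derivative is monotone on `[x,∞)` and positive at `x` tends to infinity. -/
lemma tendsto_atTop_of_monotoneOn_hasDerivAt {g g' : ℝ → ℝ} {x : ℝ}
    (hg : ∀ t : ℝ, HasDerivAt g (g' t) t) (hmono : MonotoneOn g' (Set.Ici x)) (hx : 0 < g' x) :
    Filter.Tendsto g Filter.atTop Filter.atTop := by
  have hd : ∀ t, HasDerivAt (fun t => g t - g' x * t) (g' t - g' x) t := fun t =>
    ((hg t).sub ((hasDerivAt_id t).const_mul (g' x))).congr_deriv (by rw [mul_one])
  have hm : MonotoneOn (fun t => g t - g' x * t) (Set.Ici x) := by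
    refine monotoneOn_of_hasDerivWithinAt_nonneg (convex_Ici x)
      (fun t _ => (hd t).continuousAt.continuousWithinAt)
      (fun t _ => (hd t).hasDerivWithinAt) fun t ht => ?_
    have ht' : t ∈ Set.Ici x := interior_subset ht
    exact sub_nonneg.2 (hmono Set.self_mem_Ici ht' ht')
  refine Filter.tendsto_atTop_mono' _ ?_ (Filter.tendsto_atTop_add_const_left _ (g x - g' x * x)
    (Filter.tendsto_id.const_mul_atTop hx))
  filter_upwards [Filter.eventually_ge_atTop x] with t ht
  have := hm Set.self_mem_Ici ht ht
  simp only [id] at *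
  linarith

/-- The derivative of the Mills approximant `κ·e^{−g}/g'`. -/
lemma hasDerivAt_mul_exp_neg_div {g g' : ℝ → ℝ} {κ b t : ℝ} (hg : HasDerivAt g (g' t) t)
    (hg' : HasDerivAt g' b t) (ht : g' t ≠ 0) :
    HasDerivAt (fun t => κ * Real.exp (-g t) / g' t)
      (-(κ * Real.exp (-g t) * (1 + b / g' t ^ 2))) t := by
  refine ((hg.neg.exp.const_mul κ).div hg' ht).congr_deriv ?_
  simp only [Pi.neg_apply]
  field_simp
  ring

/-- General bounds for the Mills ratio, convex case: if `g` is twice differentiable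
with `g' > 0` on `(0,∞)` and `g'' ≥ 0` on `[0,∞)`, `f = κ·e^{−g}` is integrable on
`(0,∞)`, and `M` dominates `|g''|/(g')²` on `[x,∞)` for each `x > 0`, then for every
`x > 0`:  `f(x)/(g'(x)·(1 + M(x))) ≤ I(x) ≤ f(x)/g'(x)`, where `I(x) = ∫_x^∞ f`. -/
theorem mills_ratio_bounds_convex (g g' g'' : ℝ → ℝ) (κ : ℝ) (hκ : 0 < κ)
    (hg : ∀ t : ℝ, HasDerivAt g (g' t) t)
    (hg' : ∀ t : ℝ, HasDerivAt g' (g'' t) t)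
    (hg'pos : ∀ t : ℝ, 0 < t → 0 < g' t)
    (hint : IntegrableOn (fun t => κ * Real.exp (-g t)) (Set.Ioi (0 : ℝ)))
    (M : ℝ → ℝ) (hMnonneg : ∀ x : ℝ, 0 < x → 0 ≤ M x)
    (hM : ∀ x : ℝ, 0 < x → ∀ t : ℝ, x ≤ t → |g'' t| / (g' t) ^ 2 ≤ M x)
    (hconvex : ∀ t : ℝ, 0 ≤ t → 0 ≤ g'' t)
    (x : ℝ) (hx : 0 < x) :
    κ * Real.exp (-g x) / (g' x * (1 + M x)) ≤ (∫ t in Set.Ioi x, κ * Real.exp (-g t)) ∧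
    (∫ t in Set.Ioi x, κ * Real.exp (-g t)) ≤ κ * Real.exp (-g x) / g' x := by
  have hpos : ∀ t ∈ Set.Ici x, 0 < g' t := fun t ht => hg'pos t (hx.trans_le ht)
  have hmono : MonotoneOn g' (Set.Ici x) := by
    refine monotoneOn_of_hasDerivWithinAt_nonneg (convex_Ici x)
      (fun t _ => (hg' t).continuousAt.continuousWithinAt)
      (fun t _ => (hg' t).hasDerivWithinAt) fun t ht => ?_
    have ht' : x ≤ t := interior_subset ht
    exact hconvex t (hx.le.trans ht')
  have hgx := hpos x Set.self_mem_Ici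
  have hf0 : Filter.Tendsto (fun t => κ * Real.exp (-g t)) Filter.atTop (nhds 0) := by
    simpa using (Real.tendsto_exp_neg_atTop_nhds_zero.comp
      (tendsto_atTop_of_monotoneOn_hasDerivAt hg hmono hgx)).const_mul κ
  have hF0 : Filter.Tendsto (fun t => κ * Real.exp (-g t) / g' t) Filter.atTop (nhds 0) := by
    refine tendsto_of_tendsto_of_tendsto_of_le_of_le' tendsto_const_nhds
      (by simpa using hf0.div_const (g' x)) ?_ ?_
    · filter_upwards [Filter.eventually_ge_atTop x] with t ht
      have := hpos t ht
      positivity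
    · filter_upwards [Filter.eventually_ge_atTop x] with t ht
      have := hmono Set.self_mem_Ici ht ht
      gcongr
  have hd : ∀ t ∈ Set.Ici x, HasDerivAt (fun t => κ * Real.exp (-g t) / g' t)
      (-(κ * Real.exp (-g t) * (1 + g'' t / g' t ^ 2))) t := fun t ht =>
    hasDerivAt_mul_exp_neg_div (hg t) (hg' t) (hpos t ht).ne'
  have hq : ∀ t ∈ Set.Ioi x, 0 ≤ g'' t / g' t ^ 2 := fun t ht =>
    div_nonneg (hconvex t (hx.trans ht).le) (sq_nonneg _)
  have hnonpos : ∀ t ∈ Set.Ioi x, -(κ * Real.exp (-g t) * (1 + g'' t / g' t ^ 2)) ≤ 0 :=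
    fun t ht => by
      have := hq t ht
      exact neg_nonpos.2 (by positivity)
  have hFint : IntegrableOn (fun t => κ * Real.exp (-g t) * (1 + g'' t / g' t ^ 2))
      (Set.Ioi x) := integrable_neg_iff.1 (integrableOn_Ioi_deriv_of_nonpos' hd hnonpos hF0)
  have hFval : ∫ t in Set.Ioi x, κ * Real.exp (-g t) * (1 + g'' t / g' t ^ 2) =
      κ * Real.exp (-g x) / g' x := by
    have h := integral_Ioi_of_hasDerivAt_of_nonpos' hd hnonpos hF0
    rw [integral_neg] at h
    linarith
  have hfint : IntegrableOn (fun t => κ * Real.exp (-g t)) (Set.Ioi x) :=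
    hint.mono_set (Set.Ioi_subset_Ioi hx.le)
  constructor
  · have hM1 : 0 < 1 + M x := by linarith [hMnonneg x hx]
    rw [← div_div, div_le_iff₀ hM1, ← hFval, ← integral_mul_const]
    refine setIntegral_mono_on hFint (hfint.mul_const _) measurableSet_Ioi fun t ht => ?_
    have h := hM x hx t (le_of_lt ht)
    rw [abs_of_nonneg (hconvex t (hx.trans ht).le)] at h
    gcongr
  · rw [← hFval]
    refine setIntegral_mono_on hfint hFint measurableSet_Ioi fun t ht => ?_
    exact le_mul_of_one_le_right (by positivity) (by linarith [hq t ht])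
end

section
/- (General bounds for the Mills ratio, concave case.) Assume in addition that g''(t) ≤ 0 for all t ≥ 0 and that e^{−g(t)}/g'(t) → 0 as t → ∞. Then for every x > 0 with M(x) < 1: f(x)/g'(x) ≤ I(x) ≤ f(x)/(g'(x)·(1 − M(x))). -/
open MeasureTheory

/-- General bounds for the Mills ratio, concave case: if `g` is twice differentiable
with `g' > 0` on `(0,∞)` and `g'' ≤ 0` on `[0,∞)`, `f = κ·e^{−g}` is integrable on
`(0,∞)`, `e^{−g(t)}/g'(t) → 0` as `t → ∞`, and `M` dominates `|g''|/(g')²` on `[x,∞)`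
for each `x > 0`, then for every `x > 0` with `M(x) < 1`:
`f(x)/g'(x) ≤ I(x) ≤ f(x)/(g'(x)·(1 − M(x)))`, where `I(x) = ∫_x^∞ f`. -/
theorem mills_ratio_bounds_concave (g g' g'' : ℝ → ℝ) (κ : ℝ) (hκ : 0 < κ)
    (hg : ∀ t : ℝ, HasDerivAt g (g' t) t)
    (hg' : ∀ t : ℝ, HasDerivAt g' (g'' t) t)
    (hg'pos : ∀ t : ℝ, 0 < t → 0 < g' t)
    (hint : IntegrableOn (fun t => κ * Real.exp (-g t)) (Set.Ioi (0 : ℝ)))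
    (htail : Filter.Tendsto (fun t => Real.exp (-g t) / g' t) Filter.atTop (nhds 0))
    (M : ℝ → ℝ) (hMnonneg : ∀ x : ℝ, 0 < x → 0 ≤ M x)
    (hM : ∀ x : ℝ, 0 < x → ∀ t : ℝ, x ≤ t → |g'' t| / (g' t) ^ 2 ≤ M x)
    (hconcave : ∀ t : ℝ, 0 ≤ t → g'' t ≤ 0)
    (x : ℝ) (hx : 0 < x) (hMx : M x < 1) :
    κ * Real.exp (-g x) / g' x ≤ (∫ t in Set.Ioi x, κ * Real.exp (-g t)) ∧
    (∫ t in Set.Ioi x, κ * Real.exp (-g t)) ≤ κ * Real.exp (-g x) / (g' x * (1 - M x)) := by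
  have hgpos : ∀ t ∈ Set.Ici x, 0 < g' t := fun t ht => hg'pos t (hx.trans_le ht)
  have hfpos : ∀ t, 0 < κ * Real.exp (-g t) := fun t => mul_pos hκ (Real.exp_pos _)
  have hlower : ∀ t ∈ Set.Ici x, 1 - M x ≤ 1 + g'' t / g' t ^ 2 := fun t ht => by
    have h := hM x hx t ht
    rw [abs_of_nonpos (hconcave t (hx.le.trans ht)), neg_div] at h
    linarith
  have hupper : ∀ t ∈ Set.Ici x, 1 + g'' t / g' t ^ 2 ≤ 1 := fun t ht => by
    have h := div_nonpos_of_nonpos_of_nonneg (hconcave t (hx.le.trans ht)) (sq_nonneg (g' t))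
    linarith
  have hderiv : ∀ t ∈ Set.Ici x, HasDerivAt (fun t => -(κ * (Real.exp (-g t) / g' t)))
      (κ * Real.exp (-g t) * (1 + g'' t / g' t ^ 2)) t := fun t ht => by
    have hne := (hgpos t ht).ne'
    refine (((hg t).fun_neg.exp.fun_div (hg' t) hne).const_mul κ).fun_neg.congr_deriv ?_
    field_simp
    ring
  have hnonneg : ∀ t ∈ Set.Ioi x, 0 ≤ κ * Real.exp (-g t) * (1 + g'' t / g' t ^ 2) :=
    fun t ht => mul_nonneg (hfpos t).le
      ((sub_pos.2 hMx).le.trans (hlower t (Set.Ioi_subset_Ici_self ht)))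
  have hlim : Filter.Tendsto (fun t => -(κ * (Real.exp (-g t) / g' t))) Filter.atTop
      (nhds 0) := by
    simpa using (htail.const_mul κ).neg
  have hIint := integrableOn_Ioi_deriv_of_nonneg' hderiv hnonneg hlim
  have hI := integral_Ioi_of_hasDerivAt_of_nonneg' hderiv hnonneg hlim
  rw [zero_sub, neg_neg, ← mul_div_assoc] at hI
  have hfint := hint.mono_set (Set.Ioi_subset_Ioi hx.le)
  constructor
  · rw [← hI]
    exact setIntegral_mono_on hIint hfint measurableSet_Ioi fun t ht =>
      mul_le_of_le_one_right (hfpos t).le (hupper t (Set.Ioi_subset_Ici_self ht))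
  · rw [← div_div, le_div_iff₀ (sub_pos.2 hMx), ← hI, ← integral_mul_const]
    exact setIntegral_mono_on (hfint.mul_const _) hIint measurableSet_Ioi fun t ht =>
      mul_le_mul_of_nonneg_left (hlower t (Set.Ioi_subset_Ici_self ht)) (hfpos t).le
end

section
/- (Mills-ratio bounds for the light-tailed generalized Gaussian, β > 1.) Let β > 1. For every x > 0: (1/(2·Γ(1/β))) · e^{−x^β} / ( x^{β−1} · (1 + (β−1)/(β·x^β)) ) ≤ I(x) ≤ (1/(2·Γ(1/β))) · e^{−x^β} / x^{β−1}. -/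
open MeasureTheory Set Filter Topology

theorem hasDerivAt_rpow_mul_exp_neg_rpow (β : ℝ) {t : ℝ} (ht : 0 < t) :
    HasDerivAt (fun t : ℝ ↦ t ^ (1 - β) * Real.exp (-t ^ β))
      (-((β + (β - 1) * t ^ (-β)) * Real.exp (-t ^ β))) t := by
  have h := (Real.hasDerivAt_rpow_const (p := 1 - β) (Or.inl ht.ne')).mul
    (Real.hasDerivAt_rpow_const (p := β) (Or.inl ht.ne')).neg.exp
  refine h.congr_deriv ?_
  have hcancel : t ^ (1 - β) * t ^ (β - 1) = 1 := by
    rw [← Real.rpow_add ht]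
    simp
  rw [show 1 - β - 1 = -β by ring]
  linear_combination (-β * Real.exp (-t ^ β)) * hcancel

theorem tendsto_rpow_mul_exp_neg_rpow_atTop {β : ℝ} (hβ : 0 < β) (s : ℝ) :
    Tendsto (fun t : ℝ ↦ t ^ s * Real.exp (-t ^ β)) atTop (𝓝 0) := by
  have h := (tendsto_rpow_mul_exp_neg_mul_atTop_nhds_zero (s / β) 1 one_pos).comp
    (tendsto_rpow_atTop hβ)
  refine h.congr' ?_
  filter_upwards [eventually_gt_atTop 0] with t ht
  simp only [Function.comp_apply, ← Real.rpow_mul ht.le, mul_div_cancel₀ s hβ.ne', neg_one_mul]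

theorem integral_rpow_mul_exp_neg_rpow_deriv {β x : ℝ} (hβ : 1 ≤ β) (hx : 0 < x) :
    IntegrableOn (fun t : ℝ ↦ (β + (β - 1) * t ^ (-β)) * Real.exp (-t ^ β)) (Ioi x) ∧
    ∫ t in Ioi x, (β + (β - 1) * t ^ (-β)) * Real.exp (-t ^ β) =
      x ^ (1 - β) * Real.exp (-x ^ β) := by
  have hderiv : ∀ t ∈ Ici x, HasDerivAt (fun t : ℝ ↦ -(t ^ (1 - β) * Real.exp (-t ^ β)))
      ((β + (β - 1) * t ^ (-β)) * Real.exp (-t ^ β)) t := fun t ht ↦ by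
    simpa only [neg_neg] using (hasDerivAt_rpow_mul_exp_neg_rpow β (hx.trans_le ht)).fun_neg
  have hnonneg : ∀ t ∈ Ioi x, 0 ≤ (β + (β - 1) * t ^ (-β)) * Real.exp (-t ^ β) := fun t ht ↦ by
    have ht0 : 0 < t := hx.trans ht
    have : 0 ≤ β - 1 := sub_nonneg.2 hβ
    positivity
  have hlim := (tendsto_rpow_mul_exp_neg_rpow_atTop (zero_lt_one.trans_le hβ) (1 - β)).neg
  refine ⟨integrableOn_Ioi_deriv_of_nonneg' hderiv hnonneg hlim, ?_⟩
  rw [integral_Ioi_of_hasDerivAt_of_nonneg' hderiv hnonneg hlim]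
  ring


/-- Mills-ratio bounds for the light-tailed generalized Gaussian (`β > 1`):
for every `x > 0`,
`(1/(2Γ(1/β)))·e^{−x^β}/(x^{β−1}(1 + (β−1)/(β x^β))) ≤ I(x) ≤ (1/(2Γ(1/β)))·e^{−x^β}/x^{β−1}`,
where `I(x) = ∫_x^∞ κ_β·e^{−t^β} dt` and `κ_β = β/(2Γ(1/β))`. -/
theorem mills_ratio_generalized_gaussian_light (β : ℝ) (hβ : 1 < β) (x : ℝ) (hx : 0 < x) :
    (1 / (2 * Real.Gamma (1 / β))) * Real.exp (-x ^ β) /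
        (x ^ (β - 1) * (1 + (β - 1) / (β * x ^ β)))
      ≤ (∫ t in Set.Ioi x, (β / (2 * Real.Gamma (1 / β))) * Real.exp (-t ^ β)) ∧
    (∫ t in Set.Ioi x, (β / (2 * Real.Gamma (1 / β))) * Real.exp (-t ^ β))
      ≤ (1 / (2 * Real.Gamma (1 / β))) * Real.exp (-x ^ β) / x ^ (β - 1) := by
  have hΓ : 0 < Real.Gamma (1 / β) := Real.Gamma_pos_of_pos (by positivity)
  obtain ⟨hint, hval⟩ := integral_rpow_mul_exp_neg_rpow_deriv hβ.le hx
  have hexp : IntegrableOn (fun t : ℝ ↦ β * Real.exp (-t ^ β)) (Ioi x) := by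
    have h := integrableOn_rpow_mul_exp_neg_rpow (s := 0) (by norm_num) (zero_lt_one.trans hβ)
    simp only [Real.rpow_zero, one_mul] at h
    exact (h.mono_set (Ioi_subset_Ioi hx.le)).const_mul β
  have hF : x ^ (1 - β) = (x ^ (β - 1))⁻¹ := by rw [← Real.rpow_neg hx.le, neg_sub]
  have hxβ : 0 < x ^ β := Real.rpow_pos_of_pos hx β
  have hI : (∫ t in Ioi x, β / (2 * Real.Gamma (1 / β)) * Real.exp (-t ^ β)) =
      1 / (2 * Real.Gamma (1 / β)) * ∫ t in Ioi x, β * Real.exp (-t ^ β) := by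
    rw [← integral_const_mul]
    congr 1 with t
    ring
  have hupper : (∫ t in Ioi x, β * Real.exp (-t ^ β)) ≤ x ^ (1 - β) * Real.exp (-x ^ β) := by
    rw [← hval]
    refine setIntegral_mono_on hexp hint measurableSet_Ioi fun t ht ↦ ?_
    have ht0 : 0 < t := hx.trans ht
    have : 0 ≤ (β - 1) * t ^ (-β) := mul_nonneg (by linarith) (by positivity)
    nlinarith [Real.exp_pos (-t ^ β)]
  have hlower : x ^ (1 - β) * Real.exp (-x ^ β) ≤
      (1 + (β - 1) / (β * x ^ β)) * ∫ t in Ioi x, β * Real.exp (-t ^ β) := by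
    rw [← hval, ← integral_const_mul]
    refine setIntegral_mono_on hint (hexp.const_mul _) measurableSet_Ioi fun t ht ↦ ?_
    have hmono : t ^ (-β) ≤ x ^ (-β) :=
      Real.rpow_le_rpow_of_nonpos hx (le_of_lt ht) (by linarith)
    have hfactor : (1 + (β - 1) / (β * x ^ β)) * (β * Real.exp (-t ^ β)) =
        (β + (β - 1) * x ^ (-β)) * Real.exp (-t ^ β) := by
      rw [Real.rpow_neg hx.le]
      field_simp
    rw [hfactor]
    have := mul_le_mul_of_nonneg_left hmono (sub_nonneg.2 hβ.le)
    gcongr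
  have hc : 0 < 1 + (β - 1) / (β * x ^ β) := by
    have : 0 ≤ (β - 1) / (β * x ^ β) := div_nonneg (by linarith) (by positivity)
    linarith
  rw [hF, inv_mul_eq_div] at hupper hlower
  rw [hI, mul_div_assoc, mul_div_assoc]
  constructor
  · gcongr
    rwa [← div_div, div_le_iff₀' hc]
  · gcongr
end

section
/- (Mills-ratio bounds for the heavy-tailed generalized Gaussian, 0 < β < 1.) Let 0 < β < 1. For every x > 0 satisfying (1−β)/(β·x^β) < 1: (1/(2·Γ(1/β))) · x^{1−β}·e^{−x^β} ≤ I(x) ≤ (1/(2·Γ(1/β))) · x^{1−β}·e^{−x^β} / (1 − (1−β)/(β·x^β)). -/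
open Real Set Filter Topology MeasureTheory

theorem integrableOn_exp_neg_rpow {β x : ℝ} (hβ0 : 0 < β) (hx : 0 < x) :
    IntegrableOn (fun t : ℝ => exp (-t ^ β)) (Ioi x) := by
  simpa using (integrableOn_rpow_mul_exp_neg_rpow (by norm_num : (-1 : ℝ) < 0) hβ0).mono_set
    (Ioi_subset_Ioi hx.le)

theorem integrableOn_sub_rpow_neg_mul_exp_neg_rpow {β x : ℝ} (hβ0 : 0 < β) (hβ1 : β < 1)
    (hx : 0 < x) :
    IntegrableOn (fun t : ℝ => (β - (1 - β) * t ^ (-β)) * exp (-t ^ β)) (Ioi x) := by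
  have h : IntegrableOn (fun t : ℝ => t ^ (-β) * exp (-t ^ β)) (Ioi x) :=
    (integrableOn_rpow_mul_exp_neg_rpow (by linarith) hβ0).mono_set (Ioi_subset_Ioi hx.le)
  refine (((integrableOn_exp_neg_rpow hβ0 hx).const_mul β).sub (h.const_mul (1 - β))).congr
    (ae_of_all _ fun t => ?_)
  simp only [Pi.sub_apply]
  ring

theorem hasDerivAt_rpow_one_sub_mul_exp_neg_rpow {β t : ℝ} (ht : 0 < t) :
    HasDerivAt (fun t : ℝ => t ^ (1 - β) * exp (-t ^ β))
      (-((β - (1 - β) * t ^ (-β)) * exp (-t ^ β))) t := by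
  have h1 := hasDerivAt_rpow_const (x := t) (p := 1 - β) (Or.inl ht.ne')
  have h2 := (hasDerivAt_rpow_const (x := t) (p := β) (Or.inl ht.ne')).neg.exp
  refine (h1.mul h2).congr_deriv ?_
  have e1 : t ^ (1 - β - 1) = t ^ (-β) := by congr 1; ring
  have e2 : t ^ (1 - β) * t ^ (β - 1) = 1 := by rw [← rpow_add ht]; simp
  simp only [Pi.neg_apply]
  rw [e1]
  linear_combination (-β * exp (-t ^ β)) * e2

theorem tendsto_rpow_one_sub_mul_exp_neg_rpow {β : ℝ} (hβ0 : 0 < β) :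
    Tendsto (fun t : ℝ => t ^ (1 - β) * exp (-t ^ β)) atTop (𝓝 0) := by
  refine ((tendsto_rpow_mul_exp_neg_mul_atTop_nhds_zero ((1 - β) / β) 1 one_pos).comp
    (tendsto_rpow_atTop hβ0)).congr' ?_
  filter_upwards [eventually_gt_atTop 0] with t ht
  simp only [Function.comp_apply]
  rw [← rpow_mul ht.le, mul_div_cancel₀ _ hβ0.ne', neg_one_mul]

/-- Integration by parts for the tail of `exp (-t ^ β)`, written as a single integral. -/
theorem integral_Ioi_sub_rpow_neg_mul_exp_neg_rpow {β x : ℝ} (hβ0 : 0 < β) (hβ1 : β < 1)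
    (hx : 0 < x) :
    ∫ t in Ioi x, (β - (1 - β) * t ^ (-β)) * exp (-t ^ β) = x ^ (1 - β) * exp (-x ^ β) := by
  have h := integral_Ioi_of_hasDerivAt_of_tendsto'
    (fun t ht => hasDerivAt_rpow_one_sub_mul_exp_neg_rpow (β := β) (hx.trans_le ht))
    (integrableOn_sub_rpow_neg_mul_exp_neg_rpow hβ0 hβ1 hx).neg
    (tendsto_rpow_one_sub_mul_exp_neg_rpow hβ0)
  rw [integral_neg] at h
  linarith

/-- Mills-ratio bounds for the heavy-tailed generalized Gaussian (`0 < β < 1`):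
for every `x > 0` with `(1−β)/(β x^β) < 1`,
`(1/(2Γ(1/β)))·x^{1−β}·e^{−x^β} ≤ I(x) ≤ (1/(2Γ(1/β)))·x^{1−β}·e^{−x^β}/(1 − (1−β)/(β x^β))`,
where `I(x) = ∫_x^∞ κ_β·e^{−t^β} dt` and `κ_β = β/(2Γ(1/β))`. -/
theorem mills_ratio_generalized_gaussian_heavy (β : ℝ) (hβ0 : 0 < β) (hβ1 : β < 1)
    (x : ℝ) (hx : 0 < x) (hxβ : (1 - β) / (β * x ^ β) < 1) :
    (1 / (2 * Real.Gamma (1 / β))) * (x ^ (1 - β) * Real.exp (-x ^ β))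
      ≤ (∫ t in Set.Ioi x, (β / (2 * Real.Gamma (1 / β))) * Real.exp (-t ^ β)) ∧
    (∫ t in Set.Ioi x, (β / (2 * Real.Gamma (1 / β))) * Real.exp (-t ^ β))
      ≤ (1 / (2 * Real.Gamma (1 / β))) * (x ^ (1 - β) * Real.exp (-x ^ β)) /
          (1 - (1 - β) / (β * x ^ β)) := by
  have hΓ : 0 < 1 / (2 * Gamma (1 / β)) := by
    have := Gamma_pos_of_pos (one_div_pos.2 hβ0)
    positivity
  have hexp := integrableOn_exp_neg_rpow hβ0 hx
  have hparts := integrableOn_sub_rpow_neg_mul_exp_neg_rpow hβ0 hβ1 hx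
  have hI : ∫ t in Ioi x, (β / (2 * Gamma (1 / β))) * exp (-t ^ β)
      = (1 / (2 * Gamma (1 / β))) * ∫ t in Ioi x, β * exp (-t ^ β) := by
    rw [← integral_const_mul]
    congr 1 with t
    ring
  rw [hI, mul_div_assoc]
  refine ⟨mul_le_mul_of_nonneg_left ?_ hΓ.le, mul_le_mul_of_nonneg_left ?_ hΓ.le⟩
  · rw [← integral_Ioi_sub_rpow_neg_mul_exp_neg_rpow hβ0 hβ1 hx]
    refine setIntegral_mono_on hparts (hexp.const_mul β) measurableSet_Ioi fun t ht => ?_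
    have : 0 ≤ (1 - β) * t ^ (-β) :=
      mul_nonneg (by linarith) (rpow_nonneg (hx.trans ht).le _)
    gcongr
    linarith
  · rw [le_div_iff₀ (by linarith), ← integral_Ioi_sub_rpow_neg_mul_exp_neg_rpow hβ0 hβ1 hx,
      ← integral_mul_const]
    refine setIntegral_mono_on ((hexp.const_mul β).mul_const _) hparts measurableSet_Ioi
      fun t ht => ?_
    have hpow : t ^ (-β) ≤ x ^ (-β) :=
      rpow_le_rpow_of_nonpos hx (le_of_lt ht) (by linarith)
    have hcoef : β * (1 - (1 - β) / (β * x ^ β)) = β - (1 - β) * x ^ (-β) := by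
      have := rpow_pos_of_pos hx β
      rw [rpow_neg hx.le]
      field_simp
    rw [mul_right_comm, hcoef]
    have : 0 ≤ 1 - β := by linarith
    gcongr
end
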